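/- Let ε > 0, α ∈ (0,1), N ∈ ℕ with (1−α)·N ∉ ℤ, and let Γ_ε be the quartic-kernel smoothed indicator built from γ_ε(y) = (15/16)(−(1/5)(y/ε)^5 + (2/3)(y/ε)^3 − (y/ε) + 8/15). Let Q_ε : ℝ^N → ℝ map z to the unique root Q of Σ_{i=1}^N Γ_ε(z_i − Q) = (1−α)·N. Then Q_ε is differentiable, every component of its gradient lies in [0,1], and its gradient is Lipschitz continuous on ℝ^N. -/

import Mathlib

/-- The quartic-kernel smoothed indicator function `Γ_ε`. -/
noncomputable def quarticInd (ε : ℝ) (y : ℝ) : ℝ :=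
  if y ≤ -ε then 1
  else if y < ε then (15/16) * (-(1/5) * (y/ε)^5 + (2/3) * (y/ε)^3 - (y/ε) + 8/15)
  else 0

/-- The quartic kernel, which is minus the derivative of `quarticInd ε`. -/
noncomputable def quarticKernel (ε y : ℝ) : ℝ :=
  15 / (16 * ε) * (1 - (max (-1) (min 1 (y / ε))) ^ 2) ^ 2

lemma quarticKernel_nonneg {ε : ℝ} (hε : 0 < ε) (y : ℝ) : 0 ≤ quarticKernel ε y := by
  unfold quarticKernel; positivity

lemma quarticKernel_of_le {ε y : ℝ} (hε : 0 < ε) (hy : y ≤ -ε) : quarticKernel ε y = 0 := by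
  have h : y / ε ≤ -1 := by rw [div_le_iff₀ hε]; linarith
  simp [quarticKernel, min_eq_right (h.trans (by norm_num : (-1 : ℝ) ≤ 1)), max_eq_left h]

lemma quarticKernel_of_ge {ε y : ℝ} (hε : 0 < ε) (hy : ε ≤ y) : quarticKernel ε y = 0 := by
  have h : 1 ≤ y / ε := by rw [le_div_iff₀ hε]; linarith
  simp [quarticKernel, min_eq_left h]

lemma quarticKernel_of_mem {ε y : ℝ} (hε : 0 < ε) (h₁ : -ε ≤ y) (h₂ : y ≤ ε) :
    quarticKernel ε y = 15 / (16 * ε) * (1 - (y / ε) ^ 2) ^ 2 := by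
  have h : y / ε ≤ 1 := by rw [div_le_iff₀ hε]; linarith
  have h' : -1 ≤ y / ε := by rw [le_div_iff₀ hε]; linarith
  simp [quarticKernel, min_eq_right h, max_eq_right h']

lemma quarticInd_of_le {ε y : ℝ} (hy : y ≤ -ε) : quarticInd ε y = 1 := if_pos hy

lemma quarticInd_of_ge {ε y : ℝ} (hε : 0 < ε) (hy : ε ≤ y) : quarticInd ε y = 0 := by
  rw [quarticInd, if_neg (by linarith), if_neg (by linarith)]

lemma quarticInd_of_mem {ε y : ℝ} (hε : 0 < ε) (h₁ : -ε ≤ y) (h₂ : y ≤ ε) :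
    quarticInd ε y =
      (15/16) * (-(1/5) * (y/ε)^5 + (2/3) * (y/ε)^3 - (y/ε) + 8/15) := by
  rcases h₁.eq_or_lt with rfl | h₁
  · rw [quarticInd_of_le le_rfl, neg_div, div_self hε.ne']; norm_num
  rcases h₂.eq_or_lt with rfl | h₂
  · rw [quarticInd_of_ge hε le_rfl, div_self hε.ne']; norm_num
  rw [quarticInd, if_neg (by linarith), if_pos h₂]

lemma quarticInd_eq_clamp {ε : ℝ} (hε : 0 < ε) (y : ℝ) :
    quarticInd ε y = (15/16) * (-(1/5) * (max (-1) (min 1 (y / ε)))^5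
      + (2/3) * (max (-1) (min 1 (y / ε)))^3 - (max (-1) (min 1 (y / ε))) + 8/15) := by
  rcases le_total y (-ε) with h₁ | h₁
  · have h : y / ε ≤ -1 := by rw [div_le_iff₀ hε]; linarith
    rw [quarticInd_of_le h₁, min_eq_right (h.trans (by norm_num)), max_eq_left h]; norm_num
  rcases le_total ε y with h₂ | h₂
  · have h : 1 ≤ y / ε := by rw [le_div_iff₀ hε]; linarith
    rw [quarticInd_of_ge hε h₂, min_eq_left h, max_eq_right (by norm_num)]; norm_num
  have h : y / ε ≤ 1 := by rw [div_le_iff₀ hε]; linarith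
  have h' : -1 ≤ y / ε := by rw [le_div_iff₀ hε]; linarith
  rw [quarticInd_of_mem hε h₁ h₂, min_eq_right h, max_eq_right h']

lemma hasDerivAt_quarticInd {ε : ℝ} (hε : 0 < ε) (y : ℝ) :
    HasDerivAt (quarticInd ε) (-quarticKernel ε y) y := by
  have hpoly (h₁ : -ε ≤ y) (h₂ : y ≤ ε) : HasDerivAt
      (fun y : ℝ ↦ (15/16) * (-(1/5) * (y/ε)^5 + (2/3) * (y/ε)^3 - (y/ε) + 8/15))
      (-quarticKernel ε y) y := by
    rw [quarticKernel_of_mem hε h₁ h₂]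
    have hd : HasDerivAt (fun y : ℝ ↦ y / ε) (1 / ε) y := (hasDerivAt_id y).div_const ε
    refine HasDerivAt.congr_deriv ((((((hd.pow 5).const_mul (-(1/5) : ℝ)).add ((hd.pow 3).const_mul (2/3 : ℝ))).sub
      hd).add_const (8/15 : ℝ)).const_mul (15/16 : ℝ)) ?_
    simp only [Nat.cast_ofNat, Nat.reduceSub]
    field_simp
    ring
  have hleft : HasDerivWithinAt (quarticInd ε) (-quarticKernel ε y) (Set.Iic y) y := by
    rcases le_or_gt y (-ε) with h₁ | h₁
    · rw [quarticKernel_of_le hε h₁, neg_zero]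
      exact (hasDerivWithinAt_const y _ (1 : ℝ)).congr
        (fun x hx ↦ quarticInd_of_le (le_trans hx h₁)) (quarticInd_of_le h₁)
    rcases le_or_gt y ε with h₂ | h₂
    · refine (hpoly h₁.le h₂).hasDerivWithinAt.congr_of_eventuallyEq ?_
        (quarticInd_of_mem hε h₁.le h₂)
      filter_upwards [self_mem_nhdsWithin, mem_nhdsWithin_of_mem_nhds (lt_mem_nhds h₁)]
        with x hx hx'
      exact quarticInd_of_mem hε hx'.le (le_trans hx h₂)
    · rw [quarticKernel_of_ge hε h₂.le, neg_zero]
      refine (hasDerivWithinAt_const y _ (0 : ℝ)).congr_of_eventuallyEq ?_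
        (quarticInd_of_ge hε h₂.le)
      filter_upwards [mem_nhdsWithin_of_mem_nhds (lt_mem_nhds h₂)] with x hx
      exact quarticInd_of_ge hε hx.le
  have hright : HasDerivWithinAt (quarticInd ε) (-quarticKernel ε y) (Set.Ici y) y := by
    rcases le_or_gt ε y with h₂ | h₂
    · rw [quarticKernel_of_ge hε h₂, neg_zero]
      exact (hasDerivWithinAt_const y _ (0 : ℝ)).congr
        (fun x hx ↦ quarticInd_of_ge hε (le_trans h₂ hx)) (quarticInd_of_ge hε h₂)
    rcases le_or_gt (-ε) y with h₁ | h₁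
    · refine (hpoly h₁ h₂.le).hasDerivWithinAt.congr_of_eventuallyEq ?_
        (quarticInd_of_mem hε h₁ h₂.le)
      filter_upwards [self_mem_nhdsWithin, mem_nhdsWithin_of_mem_nhds (gt_mem_nhds h₂)]
        with x hx hx'
      exact quarticInd_of_mem hε (le_trans h₁ hx) hx'.le
    · rw [quarticKernel_of_le hε h₁.le, neg_zero]
      refine (hasDerivWithinAt_const y _ (1 : ℝ)).congr_of_eventuallyEq ?_
        (quarticInd_of_le h₁.le)
      filter_upwards [mem_nhdsWithin_of_mem_nhds (gt_mem_nhds h₁)] with x hx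
      exact quarticInd_of_le hx.le
  simpa using hleft.union hright

lemma antitone_quarticInd {ε : ℝ} (hε : 0 < ε) : Antitone (quarticInd ε) :=
  antitone_of_hasDerivAt_nonpos (hasDerivAt_quarticInd hε)
    fun y ↦ neg_nonpos.2 (quarticKernel_nonneg hε y)

lemma abs_quarticKernel_sub_le {ε : ℝ} (hε : 0 < ε) (x y : ℝ) :
    |quarticKernel ε x - quarticKernel ε y| ≤ 15 / (4 * ε ^ 2) * |x - y| := by
  have hclamp : |max (-1) (min 1 (x / ε)) - max (-1) (min 1 (y / ε))| ≤ |x - y| / ε := by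
    have h := (abs_max_sub_max_le_max (-1) (min 1 (x / ε)) (-1) (min 1 (y / ε))).trans
      (max_le_max le_rfl (abs_min_sub_min_le_max 1 (x / ε) 1 (y / ε)))
    rwa [sub_self, sub_self, abs_zero, max_eq_right (abs_nonneg (x / ε - y / ε)),
      max_eq_right (abs_nonneg (x / ε - y / ε)), ← sub_div, abs_div, abs_of_pos hε] at h
  unfold quarticKernel
  have hp₁ : -1 ≤ max (-1) (min 1 (x / ε)) := le_max_left _ _
  have hp₂ : max (-1) (min 1 (x / ε)) ≤ 1 := max_le (by norm_num) (min_le_left _ _)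
  have hq₁ : -1 ≤ max (-1) (min 1 (y / ε)) := le_max_left _ _
  have hq₂ : max (-1) (min 1 (y / ε)) ≤ 1 := max_le (by norm_num) (min_le_left _ _)
  generalize max (-1) (min 1 (x / ε)) = p at *
  generalize max (-1) (min 1 (y / ε)) = q at *
  have h₁ : |p + q| ≤ 2 := abs_le.2 ⟨by linarith, by linarith⟩
  have h₂ : |p ^ 2 + q ^ 2 - 2| ≤ 2 := abs_le.2 ⟨by nlinarith, by nlinarith⟩
  calc |15 / (16 * ε) * (1 - p ^ 2) ^ 2 - 15 / (16 * ε) * (1 - q ^ 2) ^ 2|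
      = 15 / (16 * ε) * (|p + q| * |p ^ 2 + q ^ 2 - 2| * |p - q|) := by
        rw [← abs_mul, ← abs_mul, ← abs_of_pos (show 0 < 15 / (16 * ε) by positivity), ← abs_mul,
          abs_of_pos (show 0 < 15 / (16 * ε) by positivity)]
        congr 1; ring
    _ ≤ 15 / (16 * ε) * (2 * 2 * (|x - y| / ε)) := by gcongr
    _ = 15 / (4 * ε ^ 2) * |x - y| := by field_simp; ring

lemma exists_int_eq_quarticInd {ε y : ℝ} (hε : 0 < ε) (hy : quarticKernel ε y = 0) :
    ∃ k : ℤ, quarticInd ε y = k := by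
  have h : (1 - (max (-1) (min 1 (y / ε))) ^ 2) ^ 2 = 0 :=
    (mul_eq_zero.1 hy).resolve_left (by positivity)
  rw [quarticInd_eq_clamp hε]
  have h' : (max (-1) (min 1 (y / ε))) ^ 2 = 1 := by
    have := pow_eq_zero_iff (two_ne_zero) |>.1 h
    linarith
  rcases sq_eq_sq_iff_eq_or_eq_neg.1 (h'.trans (one_pow 2).symm) with h | h
  · exact ⟨0, by rw [h]; norm_num⟩
  · exact ⟨1, by rw [h]; norm_num⟩

lemma exists_int_eq_quarticInd_of_eq {ε a b : ℝ} (hε : 0 < ε) (hab : a < b)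
    (h : quarticInd ε a = quarticInd ε b) : ∃ k : ℤ, quarticInd ε a = k := by
  obtain ⟨c, hac, hcb⟩ := exists_between hab
  have hconst : ∀ x ∈ Set.Ioo a b, quarticInd ε x = quarticInd ε a := fun x hx ↦
    le_antisymm (antitone_quarticInd hε hx.1.le) (h ▸ antitone_quarticInd hε hx.2.le)
  have hderiv : HasDerivAt (quarticInd ε) 0 c :=
    (hasDerivAt_const c (quarticInd ε a)).congr_of_eventuallyEq
      (Filter.eventuallyEq_of_mem (Ioo_mem_nhds hac hcb) hconst)
  rw [← hconst c ⟨hac, hcb⟩]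
  exact exists_int_eq_quarticInd hε
    (neg_eq_zero.1 ((hasDerivAt_quarticInd hε c).unique hderiv))

lemma exists_int_eq_sum {ι : Type*} {s : Finset ι} {f : ι → ℝ}
    (h : ∀ i ∈ s, ∃ k : ℤ, f i = k) : ∃ k : ℤ, ∑ i ∈ s, f i = k := by
  choose! k hk using h
  exact ⟨∑ i ∈ s, k i, by push_cast; exact Finset.sum_congr rfl hk⟩

/-- At a non-integer level of the sum of smoothed indicators, the sum of the kernels is bounded
away from zero. -/
lemma exists_pos_le_sum_quarticKernel {ι : Type*} [Fintype ι] {ε m : ℝ} (hε : 0 < ε)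
    (hm : ∀ k : ℤ, m ≠ k) :
    ∃ c > 0, ∀ w : ι → ℝ, ∑ i, quarticInd ε (w i) = m → c ≤ ∑ i, quarticKernel ε (w i) := by
  set S : Set (ι → ℝ) := {w | ∑ i, quarticInd ε (w i) = m} with hS
  have hcontInd : Continuous (quarticInd ε) :=
    continuous_iff_continuousAt.2 fun y ↦ (hasDerivAt_quarticInd hε y).continuousAt
  have hcontKer : Continuous (quarticKernel ε) := by unfold quarticKernel; fun_prop
  have hpos : ∀ w ∈ S, 0 < ∑ i, quarticKernel ε (w i) := by
    intro w hw
    refine (Finset.sum_nonneg fun i _ ↦ quarticKernel_nonneg hε _).lt_of_ne' fun h0 ↦ ?_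
    rw [Finset.sum_eq_zero_iff_of_nonneg fun i _ ↦ quarticKernel_nonneg hε _] at h0
    obtain ⟨k, hk⟩ := exists_int_eq_sum fun i hi ↦ exists_int_eq_quarticInd hε (h0 i hi)
    exact hm k (hw.symm.trans hk)
  have hcomp : IsCompact (S ∩ Set.univ.pi fun _ ↦ Set.Icc (-ε) ε) :=
    (isCompact_univ_pi fun _ ↦ isCompact_Icc).inter_left
      (isClosed_eq (by fun_prop) continuous_const)
  have hclampInd (y : ℝ) : quarticInd ε (max (-ε) (min ε y)) = quarticInd ε y := by
    rcases le_total y (-ε) with h₁ | h₁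
    · rw [min_eq_right (by linarith), max_eq_left h₁, quarticInd_of_le h₁, quarticInd_of_le le_rfl]
    rcases le_total ε y with h₂ | h₂
    · rw [min_eq_left h₂, max_eq_right (by linarith), quarticInd_of_ge hε h₂,
        quarticInd_of_ge hε le_rfl]
    · rw [min_eq_right h₂, max_eq_right h₁]
  have hclampKer (y : ℝ) : quarticKernel ε (max (-ε) (min ε y)) = quarticKernel ε y := by
    rcases le_total y (-ε) with h₁ | h₁
    · rw [min_eq_right (by linarith), max_eq_left h₁, quarticKernel_of_le hε h₁,
        quarticKernel_of_le hε le_rfl]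
    rcases le_total ε y with h₂ | h₂
    · rw [min_eq_left h₂, max_eq_right (by linarith), quarticKernel_of_ge hε h₂,
        quarticKernel_of_ge hε le_rfl]
    · rw [min_eq_right h₂, max_eq_right h₁]
  have hclamp (w : ι → ℝ) (hw : w ∈ S) : (fun i ↦ max (-ε) (min ε (w i))) ∈
      S ∩ Set.univ.pi fun _ ↦ Set.Icc (-ε) ε := by
    refine ⟨?_, fun i _ ↦ ⟨le_max_left _ _, max_le (by linarith) (min_le_left _ _)⟩⟩
    simpa [hS, hclampInd] using hw
  rcases S.eq_empty_or_nonempty with hempty | ⟨w₀, hw₀⟩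
  · exact ⟨1, one_pos, fun w hw ↦ (hempty ▸ (show w ∈ S from hw) : w ∈ (∅ : Set _)).elim⟩
  obtain ⟨v, hv, hmin⟩ := hcomp.exists_isMinOn ⟨_, hclamp w₀ hw₀⟩
    (f := fun w ↦ ∑ i, quarticKernel ε (w i)) (by fun_prop)
  refine ⟨_, hpos v hv.1, fun w hw ↦ ?_⟩
  simpa [hclampKer] using hmin (hclamp w hw)

section SmoothedQuantile

variable {ι : Type*} [Fintype ι] {ε m : ℝ} {Q : (ι → ℝ) → ℝ}

lemma smoothedQuantile_le_add (hε : 0 < ε) (hm : ∀ k : ℤ, m ≠ k)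
    (hQ : ∀ z, ∑ i, quarticInd ε (z i - Q z) = m) (z z' : ι → ℝ) :
    Q z ≤ Q z' + ‖z - z'‖ := by
  by_contra! hlt
  have hw (i : ι) : z i - Q z < z' i - Q z' := by
    have := (le_abs_self _).trans (norm_le_pi_norm (z - z') i)
    simp only [Pi.sub_apply] at this
    linarith
  have heq := (Finset.sum_eq_sum_iff_of_le
    fun i (_ : i ∈ Finset.univ) ↦ antitone_quarticInd hε (hw i).le).1 ((hQ z').trans (hQ z).symm)
  obtain ⟨k, hk⟩ := exists_int_eq_sum fun i hi ↦
    exists_int_eq_quarticInd_of_eq hε (hw i) (heq i hi).symm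
  exact hm k ((hQ z).symm.trans hk)

lemma abs_smoothedQuantile_sub_le (hε : 0 < ε) (hm : ∀ k : ℤ, m ≠ k)
    (hQ : ∀ z, ∑ i, quarticInd ε (z i - Q z) = m) (z z' : ι → ℝ) :
    |Q z - Q z'| ≤ ‖z - z'‖ := by
  have h₁ := smoothedQuantile_le_add hε hm hQ z z'
  have h₂ := smoothedQuantile_le_add hε hm hQ z' z
  rw [norm_sub_rev] at h₂
  exact abs_le.2 ⟨by linarith, by linarith⟩

lemma abs_residual_sub_le (hε : 0 < ε) (hm : ∀ k : ℤ, m ≠ k)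
    (hQ : ∀ z, ∑ i, quarticInd ε (z i - Q z) = m) (z z' : ι → ℝ) (i : ι) :
    |(z i - Q z) - (z' i - Q z')| ≤ 2 * ‖z - z'‖ := by
  have h₁ := abs_le.1 (abs_smoothedQuantile_sub_le hε hm hQ z z')
  have h₂ := abs_le.1 (norm_le_pi_norm (z - z') i)
  simp only [Pi.sub_apply] at h₂
  exact abs_le.2 ⟨by linarith, by linarith⟩

/-- The weight of the `i`-th sample point in the gradient of the smoothed quantile. -/
noncomputable def quantileWeight (ε : ℝ) (Q : (ι → ℝ) → ℝ) (z : ι → ℝ) (i : ι) : ℝ :=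
  quarticKernel ε (z i - Q z) / ∑ j, quarticKernel ε (z j - Q z)

lemma hasFDerivAt_smoothedQuantile (hε : 0 < ε) (hm : ∀ k : ℤ, m ≠ k)
    (hQ : ∀ z, ∑ i, quarticInd ε (z i - Q z) = m) (z : ι → ℝ) :
    HasFDerivAt Q (∑ i, quantileWeight ε Q z i •
      ContinuousLinearMap.proj (R := ℝ) (φ := fun _ : ι ↦ ℝ) i) z := by
  obtain ⟨c, hc, hcle⟩ := exists_pos_le_sum_quarticKernel (ι := ι) hε hm
  have hD := hc.trans_le (hcle (fun i ↦ z i - Q z) (hQ z))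
  have hbig (i : ι) : (fun x : ι → ℝ ↦ (x i - Q x) - (z i - Q z)) =O[nhds z] fun x ↦ x - z :=
    Asymptotics.IsBigO.of_bound 2 (.of_forall fun x ↦ abs_residual_sub_le hε hm hQ x z i)
  have htendsto (i : ι) : Filter.Tendsto (fun x : ι → ℝ ↦ x i - Q x) (nhds z)
      (nhds (z i - Q z)) := by
    rw [← tendsto_sub_nhds_zero_iff]
    refine (hbig i).trans_tendsto ?_
    exact tendsto_sub_nhds_zero_iff.2 Filter.tendsto_id
  have hlittle (i : ι) := (((hasDerivAt_quarticInd hε (z i - Q z)).isLittleO.comp_tendsto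
    (htendsto i)).trans_isBigO (hbig i))
  have hsum := (Asymptotics.IsLittleO.sum fun i (_ : i ∈ Finset.univ) ↦ hlittle i).const_mul_left
    (-∑ j, quarticKernel ε (z j - Q z))⁻¹
  refine HasFDerivAt.of_isLittleO (hsum.congr_left fun x ↦ ?_)
  rw [inv_mul_eq_iff_eq_mul₀ (neg_ne_zero.2 hD.ne'), neg_mul, mul_sub]
  simp only [Finset.sum_apply, Function.comp_apply, Finset.sum_sub_distrib, hQ, sub_self, zero_sub, smul_eq_mul,
    sum_apply, smul_apply, ContinuousLinearMap.proj_apply,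
    Pi.sub_apply, quantileWeight, Finset.mul_sum, ← mul_assoc, mul_div_cancel₀ _ hD.ne']
  rw [Finset.sum_mul, ← Finset.sum_sub_distrib, neg_inj]
  refine Finset.sum_congr rfl fun i _ ↦ ?_
  ring

lemma quantileWeight_mem_Icc (hε : 0 < ε) (z : ι → ℝ) (i : ι) :
    quantileWeight ε Q z i ∈ Set.Icc (0 : ℝ) 1 := by
  have hnn (j : ι) := quarticKernel_nonneg hε (z j - Q z)
  exact ⟨div_nonneg (hnn i) (Finset.sum_nonneg fun j _ ↦ hnn j),
    div_le_one_of_le₀ (Finset.single_le_sum (fun j _ ↦ hnn j) (Finset.mem_univ i))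
      (Finset.sum_nonneg fun j _ ↦ hnn j)⟩

lemma exists_abs_quantileWeight_sub_le (hε : 0 < ε) (hm : ∀ k : ℤ, m ≠ k)
    (hQ : ∀ z, ∑ i, quarticInd ε (z i - Q z) = m) :
    ∃ C ≥ 0, ∀ (z z' : ι → ℝ) (i : ι),
      |quantileWeight ε Q z i - quantileWeight ε Q z' i| ≤ C * ‖z - z'‖ := by
  obtain ⟨c, hc, hcle⟩ := exists_pos_le_sum_quarticKernel (ι := ι) hε hm
  set L : ℝ := 15 / (4 * ε ^ 2) * 2 with hL
  refine ⟨(L + Fintype.card ι * L) / c, by positivity, fun z z' i ↦ ?_⟩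
  have hker (j : ι) : |quarticKernel ε (z j - Q z) - quarticKernel ε (z' j - Q z')| ≤
      L * ‖z - z'‖ := by
    refine (abs_quarticKernel_sub_le hε _ _).trans ?_
    rw [hL, mul_assoc]
    gcongr
    exact abs_residual_sub_le hε hm hQ z z' j
  have hsum : |∑ j, quarticKernel ε (z j - Q z) - ∑ j, quarticKernel ε (z' j - Q z')| ≤
      Fintype.card ι * L * ‖z - z'‖ := by
    rw [← Finset.sum_sub_distrib, mul_assoc]
    refine (Finset.abs_sum_le_sum_abs _ _).trans ((Finset.sum_le_sum fun j _ ↦ hker j).trans ?_)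
    simp
  have hD := hcle (fun i ↦ z i - Q z) (hQ z)
  have hD' := hcle (fun i ↦ z' i - Q z') (hQ z')
  have hw := quantileWeight_mem_Icc (Q := Q) hε z' i
  have hdecomp : quantileWeight ε Q z i - quantileWeight ε Q z' i =
      ((quarticKernel ε (z i - Q z) - quarticKernel ε (z' i - Q z')) - quantileWeight ε Q z' i *
        (∑ j, quarticKernel ε (z j - Q z) - ∑ j, quarticKernel ε (z' j - Q z'))) /
        ∑ j, quarticKernel ε (z j - Q z) := by
    have h := (hc.trans_le hD).ne'
    have h' := (hc.trans_le hD').ne'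
    simp only [quantileWeight]
    field_simp
    ring
  have hnum := (abs_sub (quarticKernel ε (z i - Q z) - quarticKernel ε (z' i - Q z'))
    (quantileWeight ε Q z' i *
      (∑ j, quarticKernel ε (z j - Q z) - ∑ j, quarticKernel ε (z' j - Q z'))))
  rw [abs_mul, abs_of_nonneg hw.1] at hnum
  have hmul := (mul_le_of_le_one_left (abs_nonneg _) hw.2).trans hsum
  rw [hdecomp, abs_div, abs_of_pos (hc.trans_le hD), div_mul_eq_mul_div, add_mul]
  exact div_le_div₀ (by positivity) (hnum.trans (add_le_add (hker i) hmul)) hc hD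

end SmoothedQuantile

/-- The smoothed quantile map `Q_ε : ℝ^N → ℝ`, sending `z` to the
unique root `Q` of `∑ i, Γ_ε (z i - Q) = (1-α)·N` (with `(1-α)·N ∉ ℤ`), is
differentiable, every component of its gradient lies in `[0,1]`, and its gradient is
Lipschitz continuous on `ℝ^N`. -/
theorem smoothed_quantile_lipschitz_gradient
    (ε α : ℝ) (hε : 0 < ε) (hα : α ∈ Set.Ioo (0 : ℝ) 1) (N : ℕ)
    (hNotInt : ∀ k : ℤ, (1 - α) * (N : ℝ) ≠ (k : ℝ))
    (Q : (Fin N → ℝ) → ℝ)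
    (hQ : ∀ z : Fin N → ℝ, ∑ i, quarticInd ε (z i - Q z) = (1 - α) * (N : ℝ)) :
    Differentiable ℝ Q ∧
    (∀ (z : Fin N → ℝ) (i : Fin N),
      fderiv ℝ Q z (Pi.single i 1) ∈ Set.Icc (0 : ℝ) 1) ∧
    ∃ K : NNReal, LipschitzWith K (fun z => fderiv ℝ Q z) := by
  have hderiv := hasFDerivAt_smoothedQuantile hε hNotInt hQ
  refine ⟨fun z ↦ (hderiv z).differentiableAt, fun z i ↦ ?_, ?_⟩
  · rw [(hderiv z).fderiv]
    simpa [sum_apply, Pi.single_apply] using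
      quantileWeight_mem_Icc (Q := Q) hε z i
  · obtain ⟨C, hC, hle⟩ := exists_abs_quantileWeight_sub_le hε hNotInt hQ
    refine ⟨(N * C).toNNReal, LipschitzWith.of_dist_le_mul fun z z' ↦ ?_⟩
    rw [Real.coe_toNNReal _ (by positivity), (hderiv z).fderiv, (hderiv z').fderiv,
      dist_eq_norm, dist_eq_norm]
    refine ContinuousLinearMap.opNorm_le_bound _ (by positivity) fun v ↦ ?_
    simp only [sub_apply, sum_apply,
      smul_apply, ContinuousLinearMap.proj_apply, smul_eq_mul,
      ← Finset.sum_sub_distrib, ← sub_mul]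
    calc _ ≤ ∑ _i : Fin N, C * ‖z - z'‖ * ‖v‖ := by
          refine norm_sum_le_of_le _ fun i _ ↦ ?_
          rw [norm_mul]
          exact mul_le_mul (hle z z' i) (norm_le_pi_norm v i) (norm_nonneg _) (by positivity)
      _ = N * C * ‖z - z'‖ * ‖v‖ := by simp; ring
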